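/- arXiv:2005.11381 — 2 statements merged into one kernel-verified Lean document; each statement's English description precedes it below -/
import Mathlib

section
/- For F in the class ℒ#, the degree is well-defined: if F satisfies two functional equations Φ_j(s) := Q_j^s G_j(s) F(s) = ω_j·conj(Φ_j(1 − conj(s))) for j = 1, 2, each of the form required by axiom (P3), then the degree of G_1 equals the degree of G_2. -/
open Complex ComplexConjugate Filter Topology MeasureTheory

noncomputable section

/-- The data of a gamma factor
`G(s) = ∏_{j=1}^{r} Γ(λ_j s + μ_j) · ∏_{j'=1}^{r'} Γ(λ'_{j'} s + μ'_{j'})⁻¹`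
as in axiom (P3). -/
structure GammaFactor where
  r : ℕ
  r' : ℕ
  lam : Fin r → ℝ
  mu : Fin r → ℂ
  lam' : Fin r' → ℝ
  mu' : Fin r' → ℂ
  lam_pos : ∀ j, 0 < lam j
  lam'_pos : ∀ j, 0 < lam' j

namespace GammaFactor

/-- The function `G(s)`. -/
def toFun (G : GammaFactor) (s : ℂ) : ℂ :=
  (∏ j, Complex.Gamma ((G.lam j : ℂ) * s + G.mu j)) /
    ∏ j, Complex.Gamma ((G.lam' j : ℂ) * s + G.mu' j)

/-- The degree `2(∑_j λ_j − ∑_{j'} λ'_{j'})` of a gamma factor. -/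
def degree (G : GammaFactor) : ℝ :=
  2 * ((∑ j, G.lam j) - ∑ j, G.lam' j)

/-- `s` avoids all poles of the gamma functions appearing in `G`. -/
def Regular (G : GammaFactor) (s : ℂ) : Prop :=
  (∀ j, ∀ n : ℕ, (G.lam j : ℂ) * s + G.mu j ≠ -(n : ℂ)) ∧
  (∀ j, ∀ n : ℕ, (G.lam' j : ℂ) * s + G.mu' j ≠ -(n : ℂ))

/-- Condition (P3'): `Re(−μ_j/λ_j) < 1/2` for all gamma shifts. -/
def Sharp (G : GammaFactor) : Prop :=
  (∀ j, (-(G.mu j) / (G.lam j : ℂ)).re < 1 / 2) ∧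
  (∀ j, (-(G.mu' j) / (G.lam' j : ℂ)).re < 1 / 2)

end GammaFactor

/-- The data `(Q, ω, G)` of a functional equation as in axiom (P3). -/
structure FunEqData where
  Q : ℝ
  Q_pos : 0 < Q
  ω : ℂ
  ω_norm : ‖ω‖ = 1
  G : GammaFactor

/-- The functional equation `Φ(s) = ω·conj(Φ(1 − conj s))` with `Φ(s) = Q^s G(s) F(s)`,
required away from an exceptional set `E` (the poles of `F`) and away from the poles of the
gamma factors. -/
def FunEqData.HoldsOff (D : FunEqData) (F : ℂ → ℂ) (E : Set ℂ) : Prop :=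
  ∀ s : ℂ, s ∉ E → (1 - conj s) ∉ E → D.G.Regular s → D.G.Regular (1 - conj s) →
    (D.Q : ℂ) ^ s * D.G.toFun s * F s =
      D.ω * conj ((D.Q : ℂ) ^ (1 - conj s) * D.G.toFun (1 - conj s) * F (1 - conj s))

/-- The class ℒ#: `F` is meromorphic (= `g/P` with `g` entire), is given by an absolutely
convergent Dirichlet series in some right half-plane (P1), `P·F` is entire (P2), and `F`
satisfies a functional equation of the shape (P3). -/
structure LSharp where
  /-- the meromorphic function, as a function on ℂ (arbitrary values at its poles) -/
  F : ℂ → ℂ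
  /-- the Dirichlet coefficients -/
  a : ℕ → ℂ
  a_zero : a 0 = 0
  a_ne_zero : ∃ n, a n ≠ 0
  abscissa_lt_top : LSeries.abscissaOfAbsConv a < ⊤
  F_eq_LSeries : ∀ s : ℂ, LSeries.abscissaOfAbsConv a < (s.re : EReal) → F s = LSeries a s
  P : Polynomial ℂ
  P_ne_zero : P ≠ 0
  g : ℂ → ℂ
  g_entire : Differentiable ℂ g
  F_eq_g_div_P : ∀ s : ℂ, P.eval s ≠ 0 → F s = g s / P.eval s
  D : FunEqData
  funEq : D.HoldsOff F {z | P.eval z = 0}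

/-- The degree of an element of ℒ# (well-defined by Theorem `uniquefnaleqn`). -/
def LSharp.deg (L : LSharp) : ℝ := L.D.G.degree

end

/-- The set of poles of `Γ(λ s + μ)`. -/
def poleSet (l : ℝ) (m : ℂ) : Set ℂ := {s | ∃ n : ℕ, (l : ℂ) * s + m = -(n : ℂ)}

open Classical in
/-- Multiplicity (0 or 1) of `s` as a pole of `Γ(λ s + μ)`. -/
noncomputable def poleMult (l : ℝ) (m : ℂ) (s : ℂ) : ℤ := if s ∈ poleSet l m then 1 else 0

lemma order_Gamma_inv_regular (z : ℂ) (hz : ∀ n : ℕ, z ≠ -(n : ℂ)) :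
    meromorphicOrderAt Complex.Gamma z = 0 := by
  have hc : ContinuousAt Complex.Gamma z := (Complex.differentiableAt_Gamma z hz).continuousAt
  rw [← tendsto_ne_zero_iff_meromorphicOrderAt_eq_zero (Meromorphic.Gamma z)]
  exact ⟨_, Complex.Gamma_ne_zero hz, hc.tendsto.mono_left nhdsWithin_le_nhds⟩

lemma order_Gamma_shift (z : ℂ) : meromorphicOrderAt (fun s => (Complex.Gamma s)⁻¹) z =
    meromorphicOrderAt (fun s : ℂ => s) z + -meromorphicOrderAt Complex.Gamma (z + 1) := by
  have h : (fun s => (Complex.Gamma s)⁻¹) =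
      (fun s : ℂ => s) * (fun s : ℂ => (Complex.Gamma (s + 1))⁻¹) := by
    funext s
    exact Complex.one_div_Gamma_eq_self_mul_one_div_Gamma_add_one s
  have hm : MeromorphicAt (fun s : ℂ => (Complex.Gamma (s + 1))⁻¹) z := by
    have := Complex.differentiable_one_div_Gamma.comp
      (differentiable_id.add_const (1 : ℂ))
    exact (Complex.analyticAt_iff_eventually_differentiableAt.2
      (Eventually.of_forall fun w => this w)).meromorphicAt
  have hi : MeromorphicAt (fun s : ℂ => s) z := analyticAt_id.meromorphicAt
  rw [h, meromorphicOrderAt_mul hi hm]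
  congr 1
  rw [show (fun s : ℂ => (Complex.Gamma (s + 1))⁻¹) = (fun s : ℂ => Complex.Gamma (s + 1))⁻¹
    from rfl, meromorphicOrderAt_inv]
  congr 1
  exact meromorphicOrderAt_comp_add_const_eq_meromorphicOrderAt

lemma order_Gamma_neg_nat (n : ℕ) :
    meromorphicOrderAt Complex.Gamma (-(n : ℂ)) = ((-1 : ℤ) : WithTop ℤ) := by
  have key : ∀ z, meromorphicOrderAt Complex.Gamma z =
      -(meromorphicOrderAt (fun s : ℂ => s) z + -meromorphicOrderAt Complex.Gamma (z + 1)) := by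
    intro z
    rw [← order_Gamma_shift, show (fun s => (Complex.Gamma s)⁻¹) = Complex.Gamma⁻¹ from rfl,
      ← meromorphicOrderAt_inv, inv_inv]
  induction n with
  | zero =>
    rw [key, order_Gamma_inv_regular]
    · have : meromorphicOrderAt (fun s : ℂ => s) 0 = 1 := meromorphicOrderAt_id
      simp only [Nat.cast_zero, neg_zero]
      rw [this]; rfl
    · intro n h
      have := congrArg Complex.re h
      simp at this
      have h2 : (0 : ℝ) ≤ n := Nat.cast_nonneg n
      linarith
  | succ n ih =>
    rw [key, show (-((n + 1 : ℕ) : ℂ) + 1) = -(n : ℂ) by push_cast; ring, ih]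
    have : meromorphicOrderAt (fun s : ℂ => s) (-((n + 1 : ℕ) : ℂ)) = 0 := by
      have hi : MeromorphicAt (fun s : ℂ => s) (-((n + 1 : ℕ) : ℂ)) := analyticAt_id.meromorphicAt
      rw [← tendsto_ne_zero_iff_meromorphicOrderAt_eq_zero hi]
      exact ⟨_, neg_ne_zero.2 (Nat.cast_ne_zero.2 n.succ_ne_zero),
        tendsto_id.mono_left nhdsWithin_le_nhds⟩
    rw [this]; rfl

lemma meromorphic_Gamma_affine (l : ℝ) (m s : ℂ) :
    MeromorphicAt (fun s : ℂ => Complex.Gamma ((l : ℂ) * s + m)) s := by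
  have := (Meromorphic.Gamma ((l : ℂ) * s + m)).comp_analyticAt
    (g := fun s : ℂ => (l : ℂ) * s + m) (x := s) (by fun_prop)
  exact this

lemma order_Gamma_affine (l : ℝ) (hl : 0 < l) (m s : ℂ) :
    meromorphicOrderAt (fun s : ℂ => Complex.Gamma ((l : ℂ) * s + m)) s =
      ((-poleMult l m s : ℤ) : WithTop ℤ) := by
  have hg : AnalyticAt ℂ (fun s : ℂ => (l : ℂ) * s + m) s := by fun_prop
  have hd : HasDerivAt (fun s : ℂ => (l : ℂ) * s + m) (l : ℂ) s := by
    simpa using ((hasDerivAt_id s).const_mul (l : ℂ)).add_const m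
  have h := meromorphicOrderAt_comp_of_deriv_ne_zero (f := Complex.Gamma) hg
    (by rw [hd.deriv]; exact_mod_cast hl.ne')
  have h' : meromorphicOrderAt (fun s : ℂ => Complex.Gamma ((l : ℂ) * s + m)) s =
    meromorphicOrderAt Complex.Gamma ((l : ℂ) * s + m) := h
  rw [h', poleMult]
  split_ifs with hs
  · obtain ⟨n, hn⟩ := hs
    rw [hn, order_Gamma_neg_nat]
  · rw [order_Gamma_inv_regular]
    · rfl
    · intro n hn
      exact hs ⟨n, hn⟩

namespace GammaFactor

/-- Net number of poles at `s`. -/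
noncomputable def netMult (G : GammaFactor) (s : ℂ) : ℤ :=
  (∑ j, poleMult (G.lam j) (G.mu j) s) - ∑ j, poleMult (G.lam' j) (G.mu' j) s

lemma meromorphic_toFun (G : GammaFactor) (s : ℂ) : MeromorphicAt G.toFun s := by
  refine MeromorphicAt.div (f := fun s => ∏ j, Complex.Gamma ((G.lam j : ℂ) * s + G.mu j))
    (g := fun s => ∏ j, Complex.Gamma ((G.lam' j : ℂ) * s + G.mu' j)) ?_ ?_
  · exact MeromorphicAt.fun_prod fun j _ => meromorphic_Gamma_affine _ _ _
  · exact MeromorphicAt.fun_prod fun j _ => meromorphic_Gamma_affine _ _ _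

lemma order_toFun (G : GammaFactor) (s : ℂ) :
    meromorphicOrderAt G.toFun s = ((-G.netMult s : ℤ) : WithTop ℤ) := by
  have e : G.toFun = (fun s => ∏ j, Complex.Gamma ((G.lam j : ℂ) * s + G.mu j)) *
     (fun s => ∏ j, Complex.Gamma ((G.lam' j : ℂ) * s + G.mu' j))⁻¹ := by
    funext s; simp [toFun, div_eq_mul_inv]
  have m1 : ∀ j ∈ Finset.univ, MeromorphicAt (fun s : ℂ => Complex.Gamma ((G.lam j : ℂ) * s + G.mu j)) s :=
    fun j _ => meromorphic_Gamma_affine _ _ _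
  have m2 : ∀ j ∈ Finset.univ, MeromorphicAt (fun s : ℂ => Complex.Gamma ((G.lam' j : ℂ) * s + G.mu' j)) s :=
    fun j _ => meromorphic_Gamma_affine _ _ _
  rw [e, meromorphicOrderAt_mul (MeromorphicAt.fun_prod m1) (MeromorphicAt.fun_prod m2).inv,
    meromorphicOrderAt_inv, meromorphicOrderAt_fun_prod m1, meromorphicOrderAt_fun_prod m2]
  simp_rw [fun j => order_Gamma_affine _ (G.lam_pos j) (G.mu j) s,
    fun j => order_Gamma_affine _ (G.lam'_pos j) (G.mu' j) s]
  rw [← WithTop.coe_sum, ← WithTop.coe_sum, netMult]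
  rw [← WithTop.LinearOrderedAddCommGroup.coe_neg, ← WithTop.coe_add]
  congr 1
  simp
  ring

lemma eventually_regular (G : GammaFactor) (s : ℂ) : ∀ᶠ z in 𝓝[≠] s, G.Regular z := by
  have aux : ∀ (l : ℝ) (_ : 0 < l) (m : ℂ), ∀ᶠ z in 𝓝[≠] s, ∀ n : ℕ, (l : ℂ) * z + m ≠ -(n : ℂ) := by
    intro l hl m
    have := (meromorphicOrderAt_ne_top_iff_eventually_ne_zero (meromorphic_Gamma_affine l m s)).1
      (by rw [order_Gamma_affine l hl]; exact WithTop.coe_ne_top)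
    filter_upwards [this] with z hz n hn
    rw [hn] at hz
    exact hz (Complex.Gamma_neg_nat_eq_zero n)
  exact (eventually_all.2 fun j => aux _ (G.lam_pos j) _).and
    (eventually_all.2 fun j => aux _ (G.lam'_pos j) _)

lemma toFun_ne_zero (G : GammaFactor) {s : ℂ} (h : G.Regular s) : G.toFun s ≠ 0 := by
  refine div_ne_zero (Finset.prod_ne_zero_iff.2 fun j _ => ?_) (Finset.prod_ne_zero_iff.2 fun j _ => ?_)
  · exact Complex.Gamma_ne_zero (h.1 j)
  · exact Complex.Gamma_ne_zero (h.2 j)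

lemma poleMult_eventually_zero (l : ℝ) (hl : 0 < l) (m : ℂ) :
    ∀ᶠ x : ℝ in atTop, ∀ s : ℂ, x ≤ s.re → poleMult l m s = 0 := by
  filter_upwards [eventually_gt_atTop (-m.re / l)] with x hx s hs
  rw [poleMult, if_neg]
  rintro ⟨n, hn⟩
  have h := congrArg Complex.re hn
  simp at h
  have h1 : (0 : ℝ) ≤ n := Nat.cast_nonneg n
  rw [div_lt_iff₀ hl] at hx
  nlinarith

lemma netMult_eventually_zero (G : GammaFactor) :
    ∀ᶠ x : ℝ in atTop, ∀ s : ℂ, x ≤ s.re → G.netMult s = 0 := by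
  filter_upwards [eventually_all.2 fun j => poleMult_eventually_zero _ (G.lam_pos j) (G.mu j),
    eventually_all.2 fun j => poleMult_eventually_zero _ (G.lam'_pos j) (G.mu' j)] with x h1 h2 s hs
  simp [netMult, h1 _ s hs, h2 _ s hs]

end GammaFactor

/-- `Q^s G(s)`. -/
noncomputable def FunEqData.K (D : FunEqData) (s : ℂ) : ℂ := (D.Q : ℂ) ^ s * D.G.toFun s

lemma FunEqData.analytic_pow (D : FunEqData) (s : ℂ) :
    AnalyticAt ℂ (fun s : ℂ => (D.Q : ℂ) ^ s) s := by
  have : Differentiable ℂ (fun s : ℂ => (D.Q : ℂ) ^ s) := by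
    intro s
    exact DifferentiableAt.const_cpow differentiableAt_id
      (Or.inl (by exact_mod_cast D.Q_pos.ne'))
  exact this.analyticAt s

lemma FunEqData.pow_ne (D : FunEqData) (s : ℂ) : (D.Q : ℂ) ^ s ≠ 0 := by
  rw [Complex.cpow_ne_zero_iff]
  exact Or.inl (by exact_mod_cast D.Q_pos.ne')

lemma FunEqData.K_ne (D : FunEqData) {s : ℂ} (h : D.G.Regular s) : D.K s ≠ 0 :=
  mul_ne_zero (D.pow_ne s) (D.G.toFun_ne_zero h)

lemma FunEqData.meromorphic_K (D : FunEqData) (s : ℂ) : MeromorphicAt D.K s :=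
  (D.analytic_pow s).meromorphicAt.mul (D.G.meromorphic_toFun s)

lemma FunEqData.order_K (D : FunEqData) (s : ℂ) :
    meromorphicOrderAt D.K s = ((-D.G.netMult s : ℤ) : WithTop ℤ) := by
  rw [← D.G.order_toFun]
  exact meromorphicOrderAt_mul_of_ne_zero (D.analytic_pow s) (D.pow_ne s)

lemma order_ratio (D₁ D₂ : FunEqData) (s : ℂ) :
    meromorphicOrderAt (D₁.K * D₂.K⁻¹) s = ((D₂.G.netMult s - D₁.G.netMult s : ℤ) : WithTop ℤ) := by
  rw [meromorphicOrderAt_mul (D₁.meromorphic_K s) (D₂.meromorphic_K s).inv, meromorphicOrderAt_inv,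
    D₁.order_K, D₂.order_K, ← WithTop.LinearOrderedAddCommGroup.coe_neg, ← WithTop.coe_add]
  congr 1
  ring

lemma LSharp.g_eventually_ne (L : LSharp) (s : ℂ) : ∀ᶠ z in 𝓝[≠] s, L.g z ≠ 0 := by
  rcases (L.g_entire.analyticAt s).eventually_eq_zero_or_eventually_ne_zero with h | h
  swap
  · exact h
  exfalso
  have hg : ∀ z, L.g z = 0 := by
    have := (L.g_entire.differentiableOn (s := Set.univ)).analyticOnNhd isOpen_univ
    intro z
    exact this.eqOn_zero_of_preconnected_of_eventuallyEq_zero isPreconnected_univ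
      (Set.mem_univ s) h (Set.mem_univ z)
  have hP : ∀ᶠ x : ℝ in atTop, L.P.eval (x : ℂ) ≠ 0 := by
    have hfin : {z : ℂ | L.P.eval z = 0}.Finite := by
      refine L.P.roots.toFinset.finite_toSet.subset fun z hz => ?_
      simpa [L.P_ne_zero] using hz
    have hfin2 : {x : ℝ | L.P.eval (x : ℂ) = 0}.Finite :=
      hfin.preimage (f := fun x : ℝ => (x : ℂ)) (Complex.ofReal_injective.injOn)
    obtain ⟨B, hB⟩ := hfin2.bddAbove
    filter_upwards [eventually_gt_atTop B] with x hx h0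
    exact absurd (hB h0) (not_le.2 hx)
  obtain ⟨A, hA1, hA2⟩ := EReal.lt_iff_exists_real_btwn.1 L.abscissa_lt_top
  have hz : (fun x : ℝ => LSeries L.a x) =ᶠ[atTop] 0 := by
    filter_upwards [hP, eventually_ge_atTop A] with x hx hxA
    rw [← L.F_eq_LSeries, L.F_eq_g_div_P _ hx, hg]
    · simp
    · refine hA1.trans_le ?_
      simpa using hxA
  rcases LSeries_eventually_eq_zero_iff'.1 hz with h | h
  · obtain ⟨n, hn⟩ := L.a_ne_zero
    rcases eq_or_ne n 0 with rfl | h0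
    · exact hn L.a_zero
    · exact hn (h n h0)
  · exact L.abscissa_lt_top.ne h

lemma LSharp.P_eventually_ne (L : LSharp) (s : ℂ) : ∀ᶠ z in 𝓝[≠] s, L.P.eval z ≠ 0 := by
  have hfin : {z : ℂ | L.P.eval z = 0}.Finite := by
    refine L.P.roots.toFinset.finite_toSet.subset fun z hz => ?_
    simpa [L.P_ne_zero] using hz
  have h := hfin.subset (Set.sdiff_subset (t := {s}))
  have h1 : ∀ᶠ z in 𝓝 s, z ∉ {z : ℂ | L.P.eval z = 0} \ {s} :=
    h.isClosed.isOpen_compl.eventually_mem (by simp)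
  rw [eventually_nhdsWithin_iff]
  filter_upwards [h1] with z hz hzs h0
  exact hz ⟨h0, hzs⟩

lemma tendsto_reflect (s : ℂ) : Tendsto (fun z : ℂ => 1 - conj z) (𝓝[≠] s) (𝓝[≠] (1 - conj s)) := by
  refine tendsto_nhdsWithin_iff.2 ⟨?_, ?_⟩
  · have : Continuous (fun z : ℂ => 1 - conj z) := by fun_prop
    exact (this.tendsto s).mono_left nhdsWithin_le_nhds
  · filter_upwards [self_mem_nhdsWithin] with z hz h
    apply hz
    have h' : (1 : ℂ) - conj z = 1 - conj s := h
    have : conj z = conj s := by linear_combination -h'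
    exact (starRingEnd ℂ).injective this

lemma ratio_eq (L : LSharp) (D₁ D₂ : FunEqData)
    (h₁ : D₁.HoldsOff L.F {z | L.P.eval z = 0})
    (h₂ : D₂.HoldsOff L.F {z | L.P.eval z = 0}) (s : ℂ) :
    ∀ᶠ z in 𝓝[≠] s, D₁.ω / D₂.ω * conj ((D₁.K * D₂.K⁻¹) (1 - conj z)) = (D₁.K * D₂.K⁻¹) z := by
  have t := tendsto_reflect s
  filter_upwards [L.g_eventually_ne s, t.eventually (L.g_eventually_ne _),
    L.P_eventually_ne s, t.eventually (L.P_eventually_ne _),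
    D₁.G.eventually_regular s, t.eventually (D₁.G.eventually_regular _),
    D₂.G.eventually_regular s, t.eventually (D₂.G.eventually_regular _)]
    with z g1 g2 p1 p2 r1 r1' r2 r2'
  have e1 := h₁ z p1 p2 r1 r1'
  have e2 := h₂ z p1 p2 r2 r2'
  have f1 : L.F z ≠ 0 := by rw [L.F_eq_g_div_P z p1]; exact div_ne_zero g1 p1
  have f2 : L.F (1 - conj z) ≠ 0 := by rw [L.F_eq_g_div_P _ p2]; exact div_ne_zero g2 p2
  change D₁.K z * L.F z = D₁.ω * conj (D₁.K (1 - conj z) * L.F (1 - conj z)) at e1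
  change D₂.K z * L.F z = D₂.ω * conj (D₂.K (1 - conj z) * L.F (1 - conj z)) at e2
  have k2 := D₂.K_ne r2
  have k2' : conj (D₂.K (1 - conj z)) ≠ 0 := (map_ne_zero _).2 (D₂.K_ne r2')
  have f2' : conj (L.F (1 - conj z)) ≠ 0 := (map_ne_zero _).2 f2
  have w2 : D₂.ω ≠ 0 := by
    intro h; have := D₂.ω_norm; simp [h] at this
  rw [Pi.mul_apply, Pi.mul_apply, Pi.inv_apply, Pi.inv_apply, map_mul, map_inv₀]
  rw [map_mul] at e1 e2
  generalize conj (D₂.K (1 - conj z)) = a at *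
  generalize conj (D₁.K (1 - conj z)) = b at *
  generalize conj (L.F (1 - conj z)) = c at *
  field_simp
  apply mul_right_cancel₀ (mul_ne_zero f1 f2')
  linear_combination D₁.ω * b * c * e2 - D₂.ω * a * c * e1

lemma netMult_eq (L : LSharp) (D₁ D₂ : FunEqData)
    (h₁ : D₁.HoldsOff L.F {z | L.P.eval z = 0})
    (h₂ : D₂.HoldsOff L.F {z | L.P.eval z = 0}) :
    ∃ B : ℝ, ∀ s : ℂ, s.re < B → D₁.G.netMult s = D₂.G.netMult s := by
  obtain ⟨A, hA1, hA2⟩ := (D₁.G.netMult_eventually_zero.and D₂.G.netMult_eventually_zero).exists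
  refine ⟨1 - A, fun s hs => ?_⟩
  have hre : A ≤ (1 - conj s).re := by simp; linarith
  have ho : meromorphicOrderAt (D₁.K * D₂.K⁻¹) (1 - conj s) = 0 := by
    rw [order_ratio, hA1 _ hre, hA2 _ hre]; rfl
  have hm : ∀ z, MeromorphicAt (D₁.K * D₂.K⁻¹) z := fun z =>
    (D₁.meromorphic_K z).mul (D₂.meromorphic_K z).inv
  obtain ⟨c, hc, hlim⟩ := (tendsto_ne_zero_iff_meromorphicOrderAt_eq_zero (hm _)).2 ho
  have w1 : D₁.ω ≠ 0 := by
    intro h; have := D₁.ω_norm; simp [h] at this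
  have w2 : D₂.ω ≠ 0 := by
    intro h; have := D₂.ω_norm; simp [h] at this
  have l2 : Tendsto (D₁.K * D₂.K⁻¹) (𝓝[≠] s) (𝓝 (D₁.ω / D₂.ω * conj c)) := by
    refine Tendsto.congr' (ratio_eq L D₁ D₂ h₁ h₂ s) ?_
    exact ((Complex.continuous_conj.tendsto c).comp (hlim.comp (tendsto_reflect s))).const_mul _
  have := (tendsto_ne_zero_iff_meromorphicOrderAt_eq_zero (hm s)).1
    ⟨_, mul_ne_zero (div_ne_zero w1 w2) ((map_ne_zero _).2 hc), l2⟩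
  rw [order_ratio] at this
  have h3 : D₂.G.netMult s - D₁.G.netMult s = 0 := by exact_mod_cast this
  omega

lemma mem_poleSet_iff {l : ℝ} (hl : 0 < l) {m s : ℂ} :
    s ∈ poleSet l m ↔ ∃ n : ℕ, s = -((n : ℂ) + m) / (l : ℂ) := by
  have hl' : (l : ℂ) ≠ 0 := by exact_mod_cast hl.ne'
  refine exists_congr fun n => ?_
  rw [eq_div_iff hl']
  constructor
  · intro h; linear_combination h
  · intro h; linear_combination h

lemma re_pole (l : ℝ) (m : ℂ) (n : ℕ) : (-((n : ℂ) + m) / (l : ℂ)).re = -((n : ℝ) + m.re) / l := by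
  rw [Complex.div_ofReal_re]; simp

/-- The strip used for counting. -/
def strip (R B : ℝ) : Set ℂ := {s | -R ≤ s.re ∧ s.re < B}

lemma pole_mem_strip {l : ℝ} (hl : 0 < l) (m : ℂ) (R B : ℝ) (n : ℕ) :
    -((n : ℂ) + m) / (l : ℂ) ∈ strip R B ↔ (n : ℝ) ≤ l * R - m.re ∧ -l * B - m.re < n := by
  rw [strip, Set.mem_ofPred_eq, re_pole, le_div_iff₀ hl, div_lt_iff₀ hl]
  constructor <;> rintro ⟨h1, h2⟩ <;> constructor <;> linarith

lemma finite_poles {l : ℝ} (hl : 0 < l) (m : ℂ) (R B : ℝ) : (poleSet l m ∩ strip R B).Finite := by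
  refine ((Finset.range (⌊l * R - m.re⌋₊ + 1)).finite_toSet.image
    (fun n : ℕ => -((n : ℂ) + m) / (l : ℂ))).subset ?_
  rintro s ⟨h1, h2⟩
  obtain ⟨n, rfl⟩ := (mem_poleSet_iff hl).1 h1
  rw [pole_mem_strip hl] at h2
  refine ⟨n, ?_, rfl⟩
  simpa [Nat.lt_succ_iff] using Nat.le_floor h2.1

lemma count_poles {l : ℝ} (hl : 0 < l) (m : ℂ) (B : ℝ) :
    ∃ K : ℝ, ∀ᶠ R : ℝ in atTop, ∀ S : Finset ℂ, (∀ s ∈ S, s ∈ strip R B) →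
      (∀ s ∈ poleSet l m, s ∈ strip R B → s ∈ S) →
      |((∑ s ∈ S, poleMult l m s : ℤ) : ℝ) - l * R| ≤ K := by
  classical
  set c : ℕ := (⌊-l * B - m.re⌋ + 1).toNat with hc
  refine ⟨|m.re| + 1 + c, ?_⟩
  filter_upwards [eventually_ge_atTop ((c + m.re) / l)] with R hR S hS1 hS2
  rw [div_le_iff₀ hl] at hR
  have hM : (c : ℝ) ≤ l * R - m.re := by linarith
  have hM0 : 0 ≤ l * R - m.re := le_trans (Nat.cast_nonneg c) hM
  set f : ℕ → ℂ := fun n => -((n : ℂ) + m) / (l : ℂ) with hf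
  have hl' : (l : ℂ) ≠ 0 := by exact_mod_cast hl.ne'
  have finj : Function.Injective f := by
    intro a b hab
    have h1 : -((a : ℂ) + m) = -((b : ℂ) + m) := (div_left_inj' hl').1 hab
    have h2 : (a : ℂ) = b := by linear_combination -h1
    exact_mod_cast h2
  have hcn : ∀ n : ℕ, -l * B - m.re < n ↔ c ≤ n := by
    intro n
    rw [hc, Int.toNat_le, Int.add_one_le_iff, Int.floor_lt]
    simp
  have himg : S.filter (fun s => s ∈ poleSet l m) =
      (Finset.Ico c (⌊l * R - m.re⌋₊ + 1)).image f := by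
    ext s
    simp only [Finset.mem_filter, Finset.mem_image, Finset.mem_Ico, Nat.lt_succ_iff]
    constructor
    · rintro ⟨h1, h2⟩
      obtain ⟨n, rfl⟩ := (mem_poleSet_iff hl).1 h2
      have h3 := (pole_mem_strip hl m R B n).1 (hS1 _ h1)
      exact ⟨n, ⟨(hcn n).1 h3.2, Nat.le_floor h3.1⟩, rfl⟩
    · rintro ⟨n, ⟨h1, h2⟩, rfl⟩
      have hp : f n ∈ poleSet l m := (mem_poleSet_iff hl).2 ⟨n, rfl⟩
      exact ⟨hS2 _ hp ((pole_mem_strip hl m R B n).2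
        ⟨(Nat.le_floor_iff hM0).1 h2, (hcn n).2 h1⟩), hp⟩
  have hsum : (∑ s ∈ S, poleMult l m s : ℤ) = ((⌊l * R - m.re⌋₊ + 1 - c : ℕ) : ℤ) := by
    have : (∑ s ∈ S, poleMult l m s : ℤ) = ((S.filter (fun s => s ∈ poleSet l m)).card : ℤ) := by
      simp [poleMult]
    rw [this, himg, Finset.card_image_of_injective _ finj, Nat.card_Ico]
  have hle : c ≤ ⌊l * R - m.re⌋₊ := Nat.le_floor hM
  rw [hsum, Int.cast_natCast, Nat.cast_sub (by omega)]
  push_cast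
  have a1 := Nat.floor_le hM0
  have a2 := Nat.lt_floor_add_one (l * R - m.re)
  have a3 := neg_abs_le m.re
  have a4 := le_abs_self m.re
  have a5 : (0 : ℝ) ≤ c := Nat.cast_nonneg c
  rw [abs_le]
  constructor <;> linarith

lemma count_sum {n : ℕ} (l : Fin n → ℝ) (hl : ∀ j, 0 < l j) (m : Fin n → ℂ) (B : ℝ) :
    ∃ K : ℝ, ∀ᶠ R : ℝ in atTop, ∀ S : Finset ℂ, (∀ s ∈ S, s ∈ strip R B) →
      (∀ j, ∀ s ∈ poleSet (l j) (m j), s ∈ strip R B → s ∈ S) →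
      |((∑ s ∈ S, ∑ j, poleMult (l j) (m j) s : ℤ) : ℝ) - (∑ j, l j) * R| ≤ K := by
  choose K hK using fun j => count_poles (hl j) (m j) B
  refine ⟨∑ j, K j, ?_⟩
  filter_upwards [eventually_all.2 hK] with R hR S h1 h2
  rw [Finset.sum_comm, Finset.sum_mul, Int.cast_sum, ← Finset.sum_sub_distrib]
  exact (Finset.abs_sum_le_sum_abs _ _).trans
    (Finset.sum_le_sum fun j _ => hR j S h1 (h2 j))

/-- `S` contains all zeros and poles of `G` in the strip. -/
def GammaFactor.Good (G : GammaFactor) (R B : ℝ) (S : Finset ℂ) : Prop :=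
  (∀ j, ∀ s ∈ poleSet (G.lam j) (G.mu j), s ∈ strip R B → s ∈ S) ∧
  (∀ j, ∀ s ∈ poleSet (G.lam' j) (G.mu' j), s ∈ strip R B → s ∈ S)

lemma GammaFactor.count (G : GammaFactor) (B : ℝ) :
    ∃ K : ℝ, ∀ᶠ R : ℝ in atTop, ∀ S : Finset ℂ, (∀ s ∈ S, s ∈ strip R B) → G.Good R B S →
      |((∑ s ∈ S, G.netMult s : ℤ) : ℝ) - G.degree / 2 * R| ≤ K := by
  obtain ⟨K, hK⟩ := count_sum G.lam G.lam_pos G.mu B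
  obtain ⟨K', hK'⟩ := count_sum G.lam' G.lam'_pos G.mu' B
  refine ⟨K + K', ?_⟩
  filter_upwards [hK, hK'] with R h h' S hS hG
  have e := abs_le.1 (h S hS hG.1)
  have e' := abs_le.1 (h' S hS hG.2)
  simp only [GammaFactor.netMult, Finset.sum_sub_distrib, GammaFactor.degree, Int.cast_sub]
  rw [abs_le]
  constructor <;> linarith

lemma GammaFactor.exists_finite (G : GammaFactor) (R B : ℝ) :
    ∃ T : Set ℂ, T.Finite ∧ T ⊆ strip R B ∧ ∀ S : Finset ℂ, T ⊆ S → G.Good R B S := by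
  refine ⟨(⋃ j, poleSet (G.lam j) (G.mu j) ∩ strip R B) ∪
    ⋃ j, poleSet (G.lam' j) (G.mu' j) ∩ strip R B, ?_, ?_, ?_⟩
  · exact (Set.finite_iUnion fun j => finite_poles (G.lam_pos j) _ _ _).union
      (Set.finite_iUnion fun j => finite_poles (G.lam'_pos j) _ _ _)
  · exact Set.union_subset (Set.iUnion_subset fun j => Set.inter_subset_right)
      (Set.iUnion_subset fun j => Set.inter_subset_right)
  · intro S hS
    exact ⟨fun j s h1 h2 => hS (Or.inl (Set.mem_iUnion.2 ⟨j, h1, h2⟩)),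
      fun j s h1 h2 => hS (Or.inr (Set.mem_iUnion.2 ⟨j, h1, h2⟩))⟩

lemma degree_eq_of_netMult (G₁ G₂ : GammaFactor) (B : ℝ)
    (h : ∀ s : ℂ, s.re < B → G₁.netMult s = G₂.netMult s) : G₁.degree = G₂.degree := by
  obtain ⟨K₁, h₁⟩ := G₁.count B
  obtain ⟨K₂, h₂⟩ := G₂.count B
  by_contra hne
  have hpos : 0 < |G₁.degree - G₂.degree| := abs_pos.2 (sub_ne_zero.2 hne)
  obtain ⟨R, ⟨hR1, hR2⟩, hR, hR0⟩ := ((h₁.and h₂).and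
    ((eventually_gt_atTop ((K₁ + K₂) * 2 / |G₁.degree - G₂.degree|)).and
      (eventually_ge_atTop 0))).exists
  obtain ⟨T₁, f1, s1, g1⟩ := G₁.exists_finite R B
  obtain ⟨T₂, f2, s2, g2⟩ := G₂.exists_finite R B
  set S := (f1.union f2).toFinset with hS
  have hSs : ∀ s ∈ S, s ∈ strip R B := by
    intro s hs
    rw [hS, Set.Finite.mem_toFinset] at hs
    exact hs.elim (fun h => s1 h) (fun h => s2 h)
  have e1 := hR1 S hSs (g1 S (by rw [hS, Set.Finite.coe_toFinset]; exact Set.subset_union_left))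
  have e2 := hR2 S hSs (g2 S (by rw [hS, Set.Finite.coe_toFinset]; exact Set.subset_union_right))
  rw [Finset.sum_congr rfl fun s hs => h s (hSs s hs).2] at e1
  rw [div_lt_iff₀ hpos] at hR
  have e3 : |G₁.degree - G₂.degree| * R ≤ (K₁ + K₂) * 2 := by
    rw [← abs_of_nonneg hR0, ← abs_mul]
    rw [abs_le] at e1 e2 ⊢
    constructor <;> linarith
  linarith

/-- **Theorem (degree is well defined).** If `F ∈ ℒ#` satisfies two functional equations
`Φ_j(s) := Q_j^s G_j(s) F(s) = ω_j conj(Φ_j(1 - conj s))`, `j = 1, 2`, of the form required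
by axiom (P3), then the degrees of `G_1` and `G_2` agree. -/
theorem degree_well_defined (L : LSharp) (D₁ D₂ : FunEqData)
    (h₁ : D₁.HoldsOff L.F {z | L.P.eval z = 0})
    (h₂ : D₂.HoldsOff L.F {z | L.P.eval z = 0}) :
    D₁.G.degree = D₂.G.degree := by
  obtain ⟨B, hB⟩ := netMult_eq L D₁ D₂ h₁ h₂
  exact degree_eq_of_netMult D₁.G D₂.G B hB
end

section
/- If F belongs to the class 𝔄^∞ (i.e., F satisfies (P1), (P2) and (P3')) and F satisfies two functional equations Φ_j(s) := Q_j^s G_j(s) F(s) = ω_j·conj(Φ_j(1 − conj(s))) for j = 1, 2, each of the form required by (P3'), then there is a constant c ∈ ℂ such that Q_1^s G_1(s) = c·Q_2^s G_2(s) for all s. -/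
open Complex ComplexConjugate Filter Topology MeasureTheory

lemma real_digamma_bound (x : ℝ) (hx : 0 < x) :
    ∃ p : ℝ, Complex.digamma x = p ∧ p ≤ Real.log x ∧ Real.log x - 1 / x ≤ p := by
  have hd : ∀ y : ℝ, 0 < y → DifferentiableAt ℝ Real.Gamma y := fun y hy =>
    Real.differentiableAt_Gamma (fun m h => by have : (0:ℝ) ≤ m := Nat.cast_nonneg m; linarith)
  have key : ∀ y : ℝ, 0 < y → Complex.digamma y = ((deriv Real.Gamma y / Real.Gamma y : ℝ) : ℂ) := by
    intro y hy
    have h1 : HasDerivAt Complex.Gamma (deriv Complex.Gamma y) (y : ℂ) := by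
      apply DifferentiableAt.hasDerivAt
      apply Complex.differentiableAt_Gamma
      intro m h
      have := congrArg Complex.re h
      simp at this
      have : (0:ℝ) ≤ m := Nat.cast_nonneg m; linarith
    have h2 := h1.comp_ofReal
    have h3 := (hd y hy).hasDerivAt.ofReal_comp
    simp only [Complex.Gamma_ofReal] at h2
    have h4 := h2.unique h3
    rw [Complex.digamma_def, logDeriv_apply, h4, Complex.Gamma_ofReal]
    push_cast; rfl
  have hlog : ∀ y : ℝ, 0 < y → HasDerivAt (Real.log ∘ Real.Gamma) (deriv Real.Gamma y / Real.Gamma y) y :=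
    fun y hy => (hd y hy).hasDerivAt.log (Real.Gamma_pos_of_pos hy).ne'
  have hsl : slope (Real.log ∘ Real.Gamma) x (x + 1) = Real.log x := by
    rw [slope_def_field]
    simp only [Function.comp]
    rw [Real.Gamma_add_one hx.ne', Real.log_mul hx.ne' (Real.Gamma_pos_of_pos hx).ne']
    simp
  refine ⟨_, key x hx, ?_, ?_⟩
  · rw [← hsl]
    exact Real.convexOn_log_Gamma.le_slope_of_hasDerivAt (Set.mem_Ioi.2 hx) (Set.mem_Ioi.2 (by linarith)) (by linarith) (hlog x hx)
  · have h1 := Real.convexOn_log_Gamma.slope_le_of_hasDerivAt (Set.mem_Ioi.2 hx) (Set.mem_Ioi.2 (by linarith)) (by linarith) (hlog (x+1) (by linarith))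
    rw [hsl] at h1
    have h2 := Complex.digamma_apply_add_one (x : ℂ) (by
      intro m h
      have := congrArg Complex.re h
      simp at this
      have : (0:ℝ) ≤ m := Nat.cast_nonneg m; linarith)
    have h3 := key (x+1) (by linarith)
    push_cast at h3
    rw [h3, key x hx] at h2
    have h4 : deriv Real.Gamma (x+1) / Real.Gamma (x+1) = deriv Real.Gamma x / Real.Gamma x + x⁻¹ := by exact_mod_cast h2
    rw [h4] at h1
    rw [one_div]; linarith

/-- error terms -/
noncomputable def eterm (k : ℕ) (z : ℂ) : ℂ := Complex.log (z + k + 1) - Complex.log (z + k) - (z + k)⁻¹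

lemma slit_of_re {z : ℂ} (h : 0 < z.re) : z ∈ Complex.slitPlane := Or.inl h

lemma eterm_bound (k : ℕ) (z : ℂ) (hz : 0 < z.re) : ‖eterm k z‖ ≤ 1 / (z.re + k) ^ 2 := by
  have hk : (0:ℝ) ≤ k := Nat.cast_nonneg k
  set w : ℂ := z + k with hw
  have hwre : w.re = z.re + k := by simp [hw]
  have hwpos : 0 < w.re := by rw [hwre]; linarith
  have hw0 : w ≠ 0 := fun h => by rw [h] at hwpos; simp at hwpos
  have hwt : ∀ t : ℝ, 0 ≤ t → 0 < (w + t).re := fun t ht => by simp; linarith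
  have hder : ∀ t ∈ Set.Icc (0:ℝ) 1, HasDerivWithinAt (fun t : ℝ => Complex.log (w + t) - t * w⁻¹)
      ((w + t)⁻¹ - w⁻¹) (Set.Icc 0 1) t := by
    intro t ht
    have h1 : HasDerivAt (fun u : ℂ => Complex.log (w + u) - u * w⁻¹) ((w + t)⁻¹ - w⁻¹) (t : ℂ) := by
      have h2 := ((hasDerivAt_id (t : ℂ)).const_add w).clog (slit_of_re (hwt t ht.1))
      have h3 := (hasDerivAt_id (t : ℂ)).mul_const w⁻¹
      exact (h2.sub h3).congr_deriv (by simp)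
    exact h1.comp_ofReal.hasDerivWithinAt
  have hb := norm_image_sub_le_of_norm_deriv_le_segment' hder (C := 1 / (z.re + k) ^ 2) (by
    intro t ht
    have hne : w + t ≠ 0 := fun h => by have := hwt t ht.1; rw [h] at this; simp at this
    have : (w + t)⁻¹ - w⁻¹ = - t / ((w + t) * w) := by field_simp; ring
    rw [this, norm_div, norm_mul, norm_neg]
    rw [Complex.norm_real, Real.norm_of_nonneg ht.1]
    have e1 : z.re + k ≤ ‖w‖ := hwre ▸ Complex.re_le_norm w
    have e2 : z.re + k ≤ ‖w + t‖ := by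
      refine le_trans ?_ (Complex.re_le_norm _)
      simp [hwre]; exact ht.1
    have e3 : 0 < z.re + k := by linarith
    rw [sq]
    apply div_le_div₀ (by norm_num) ht.2.le (by positivity)
    exact mul_le_mul e2 e1 e3.le (by positivity)) 1 (by simp)
  have heq : eterm k z = (Complex.log (w + (1:ℝ)) - (1:ℝ) * w⁻¹) - (Complex.log (w + (0:ℝ)) - (0:ℝ) * w⁻¹) := by
    simp [eterm, hw]; ring
  rw [heq]
  simpa using hb

lemma summable_bd (d : ℝ) (hd : 0 < d) : Summable (fun k : ℕ => 1 / (d + k) ^ 2) := by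
  have := (Real.summable_one_div_nat_add_rpow d 2).2 (by norm_num)
  refine this.congr fun k => ?_
  rw [abs_of_pos (by positivity)]
  norm_cast
  rw [add_comm]

noncomputable def Eser (z : ℂ) : ℂ := ∑' k, eterm k z

lemma Eser_bound (d : ℝ) (hd : 0 < d) (z : ℂ) (hz : d ≤ z.re) : ‖Eser z‖ ≤ ∑' k : ℕ, 1 / (d + k) ^ 2 := by
  apply tsum_of_norm_bounded (summable_bd d hd).hasSum
  intro k
  refine (eterm_bound k z (by linarith)).trans ?_
  gcongr

lemma summable_eterm (z : ℂ) (hz : 0 < z.re) : Summable (fun k => eterm k z) :=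
  Summable.of_norm_bounded (summable_bd z.re hz) (fun k => eterm_bound k z hz)

lemma eterm_diff (k : ℕ) (z : ℂ) (hz : 0 < z.re) : DifferentiableAt ℂ (eterm k) z := by
  have hk : (0:ℝ) ≤ k := Nat.cast_nonneg k
  have h1 : 0 < (z + k).re := by simp; linarith
  have h2 : 0 < (z + k + 1).re := by simp; linarith
  have h3 : z + k ≠ 0 := fun h => by rw [h] at h1; simp at h1
  unfold eterm
  refine DifferentiableAt.sub (DifferentiableAt.sub ?_ ?_) ?_
  · exact DifferentiableAt.clog (by fun_prop) (slit_of_re h2)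
  · exact DifferentiableAt.clog (by fun_prop) (slit_of_re h1)
  · exact DifferentiableAt.inv (by fun_prop) h3

lemma Eser_diff (z : ℂ) (hz : 0 < z.re) : DifferentiableAt ℂ Eser z := by
  have ho : IsOpen {w : ℂ | z.re / 2 < w.re} := isOpen_lt continuous_const Complex.continuous_re
  have h := Complex.differentiableOn_tsum_of_summable_norm (F := eterm) (summable_bd (z.re/2) (by linarith))
    (fun k w hw => (eterm_diff k w (by have : z.re / 2 < w.re := hw; linarith)).differentiableWithinAt) ho
    (fun k w hw => by
      have : z.re / 2 < w.re := hw
      refine (eterm_bound k w (by linarith)).trans ?_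
      gcongr)
  exact h.differentiableAt (ho.mem_nhds (by show z.re/2 < z.re; linarith))

lemma ne_neg_nat {z : ℂ} (hz : 0 < z.re) (m : ℕ) : z ≠ -(m : ℂ) := by
  intro h
  have h1 := congrArg Complex.re h
  simp at h1
  have : (0:ℝ) ≤ m := Nat.cast_nonneg m; linarith

lemma partial_sum (z : ℂ) (hz : 0 < z.re) (n : ℕ) : ∑ k ∈ Finset.range n, eterm k z =
    Complex.log (z + n) - Complex.digamma (z + n) - (Complex.log z - Complex.digamma z) := by
  induction n with
  | zero => simp
  | succ n ih =>
    rw [Finset.sum_range_succ, ih, eterm]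
    have hk : (0:ℝ) ≤ n := Nat.cast_nonneg n
    have := Complex.digamma_apply_add_one (z + n) (ne_neg_nat (by simp; linarith))
    push_cast
    rw [← add_assoc, this]; ring

lemma digamma_real (x : ℝ) (hx : 0 < x) : Complex.digamma x = Complex.log x + Eser x := by
  have h1 := (summable_eterm (x : ℂ) (by simpa)).hasSum.tendsto_sum_nat
  have h2 : Tendsto (fun n : ℕ => Complex.log ((x:ℂ) + n) - Complex.digamma ((x:ℂ) + n)) atTop (𝓝 0) := by
    apply squeeze_zero_norm (a := fun n : ℕ => 1 / (x + n))
    · intro n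
      have hn : 0 < x + n := by positivity
      obtain ⟨p, hp, h3, h4⟩ := real_digamma_bound (x + n) hn
      push_cast at hp
      rw [hp]
      have : Complex.log ((x:ℂ) + n) = (Real.log (x + n) : ℝ) := by
        rw [Complex.ofReal_log hn.le]; push_cast; rfl
      rw [this, ← Complex.ofReal_sub, Complex.norm_real, Real.norm_eq_abs, abs_le]
      constructor
      · have : 0 < 1 / (x + n) := by positivity
        linarith
      · linarith
    · have : Tendsto (fun n : ℕ => x + (n:ℝ)) atTop atTop := tendsto_atTop_add_const_left _ _ tendsto_natCast_atTop_atTop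
      simp only [one_div]
      exact this.inv_tendsto_atTop
  have h3 := h2.sub_const (Complex.log x - Complex.digamma x)
  simp_rw [partial_sum (x:ℂ) (by simpa)] at h1
  have h4 := tendsto_nhds_unique h1 h3
  have h5 : Eser x = 0 - (Complex.log x - Complex.digamma x) := h4
  rw [h5]; ring

lemma analyticAt_Gamma' {z : ℂ} (hz : ∀ m : ℕ, z ≠ -(m : ℂ)) : AnalyticAt ℂ Complex.Gamma z := by
  have h := (Complex.differentiable_one_div_Gamma.analyticAt z).inv (inv_ne_zero (Complex.Gamma_ne_zero hz))
  refine h.congr (Eventually.of_forall fun w => ?_)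
  simp

lemma digamma_analyticAt (z : ℂ) (hz : 0 < z.re) : AnalyticAt ℂ Complex.digamma z := by
  have h := analyticAt_Gamma' (ne_neg_nat hz)
  rw [Complex.digamma_def]
  exact h.deriv.div h (Complex.Gamma_ne_zero (ne_neg_nat hz))

lemma digamma_eq (z : ℂ) (hz : 0 < z.re) : Complex.digamma z = Complex.log z + Eser z := by
  have ho : IsOpen {w : ℂ | 0 < w.re} := isOpen_lt continuous_const Complex.continuous_re
  have hc : IsPreconnected {w : ℂ | 0 < w.re} := (convex_halfSpace_re_gt 0).isPreconnected
  have ha : AnalyticOnNhd ℂ Complex.digamma {w : ℂ | 0 < w.re} := fun w hw => digamma_analyticAt w hw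
  have hb : AnalyticOnNhd ℂ (fun z => Complex.log z + Eser z) {w : ℂ | 0 < w.re} := by
    apply DifferentiableOn.analyticOnNhd _ ho
    intro w hw
    exact ((Complex.differentiableAt_log (slit_of_re hw)).add (Eser_diff w hw)).differentiableWithinAt
  refine ha.eqOn_of_preconnected_of_frequently_eq hb hc (z₀ := ((1:ℝ) : ℂ)) (by simp) ?_ hz
  have ht : Tendsto (fun n : ℕ => (((1 : ℝ) + 1 / ((n:ℝ) + 1) : ℝ) : ℂ)) atTop (𝓝[≠] ((1:ℝ) : ℂ)) := by
    rw [tendsto_nhdsWithin_iff]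
    constructor
    · apply (Complex.continuous_ofReal.tendsto _).comp
      simpa using (tendsto_one_div_add_atTop_nhds_zero_nat (𝕜 := ℝ)).const_add 1
    · refine Eventually.of_forall fun n => ?_
      simp only [Set.mem_compl_iff, Set.mem_singleton_iff, Complex.ofReal_inj]
      have : (0:ℝ) < 1 / ((n:ℝ) + 1) := by positivity
      linarith
  refine ht.frequently (Eventually.frequently (Eventually.of_forall fun n => ?_))
  exact digamma_real _ (by positivity)

lemma digamma_bound (d : ℝ) (hd : 0 < d) : ∃ C : ℝ, ∀ z : ℂ, d ≤ z.re → ‖Complex.digamma z‖ ≤ C + 2 * √‖z‖ := by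
  refine ⟨|Real.log d| + Real.pi + ∑' k : ℕ, 1 / (d + k) ^ 2, fun z hz => ?_⟩
  have hz0 : 0 < z.re := by linarith
  rw [digamma_eq z hz0]
  refine (norm_add_le _ _).trans ?_
  have h1 := Eser_bound d hd z hz
  have hn : d ≤ ‖z‖ := hz.trans (Complex.re_le_norm z)
  have hn0 : 0 < ‖z‖ := by linarith
  have h2 : ‖Complex.log z‖ ≤ |Real.log d| + 2 * √‖z‖ + Real.pi := by
    refine (Complex.norm_le_abs_re_add_abs_im _).trans ?_
    rw [Complex.log_re, Complex.log_im]
    refine add_le_add ?_ (Complex.abs_arg_le_pi z)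
    have h3 : Real.log ‖z‖ ≤ 2 * √‖z‖ := by
      have := Real.log_le_sub_one_of_pos (Real.sqrt_pos.2 hn0)
      rw [Real.log_sqrt hn0.le] at this
      have : 0 ≤ √‖z‖ := by positivity
      linarith
    have h4 := Real.log_le_log hd hn
    have h5 := neg_abs_le (Real.log d)
    have h6 : 0 ≤ √‖z‖ := by positivity
    have h7 := abs_nonneg (Real.log d)
    rw [abs_le]; constructor <;> linarith
  linarith

lemma digamma_im (l : ℝ) (hl : 0 < l) (m : ℂ) :
    Tendsto (fun x : ℝ => (Complex.digamma ((l:ℂ) * x + m)).im) atTop (𝓝 0) := by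
  have hre : ∀ x : ℝ, ((l:ℂ) * x + m).re = l * x + m.re := by intro x; simp
  have hlin : Tendsto (fun x : ℝ => l * x + m.re) atTop atTop :=
    tendsto_atTop_add_const_right _ _ (tendsto_id.const_mul_atTop hl)
  have hE : Tendsto (fun x : ℝ => Eser ((l:ℂ) * x + m)) atTop (𝓝 0) := by
    have := tendsto_tsum_of_dominated_convergence (𝓕 := (atTop : Filter ℝ))
      (f := fun x k => eterm k ((l:ℂ) * x + m)) (g := fun _ => 0)
      (bound := fun k : ℕ => 1 / ((1:ℝ) + k) ^ 2) (summable_bd 1 one_pos) (by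
        intro k
        have h2 : Tendsto (fun x : ℝ => 1 / (l * x + m.re + k) ^ 2) atTop (𝓝 0) := by
          simp only [one_div]
          apply Tendsto.inv_tendsto_atTop
          apply (tendsto_pow_atTop (by norm_num)).comp
          exact tendsto_atTop_add_const_right _ _ hlin
        apply squeeze_zero_norm' _ h2
        filter_upwards [hlin.eventually_gt_atTop 0] with x hx
        have := eterm_bound k ((l:ℂ) * x + m) (by rw [hre]; exact hx)
        rwa [hre] at this) (by
        filter_upwards [hlin.eventually_gt_atTop 1] with x hx k
        have := eterm_bound k ((l:ℂ) * x + m) (by rw [hre]; linarith)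
        rw [hre] at this
        refine this.trans ?_
        gcongr)
    simpa [Eser] using this
  have hA : Tendsto (fun x : ℝ => Complex.arg ((l:ℂ) * x + m)) atTop (𝓝 0) := by
    have h1 : Tendsto (fun x : ℝ => (l:ℂ) + m * ((x⁻¹ : ℝ) : ℂ)) atTop (𝓝 ((l:ℂ) + m * ((0:ℝ):ℂ))) :=
      (((Complex.continuous_ofReal.tendsto 0).comp tendsto_inv_atTop_zero).const_mul m).const_add _
    have h2 : ContinuousAt Complex.arg ((l:ℂ) + m * ((0:ℝ):ℂ)) := Complex.continuousAt_arg (by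
      left; simpa)
    have h3 := h2.tendsto.comp h1
    have h4 : Complex.arg ((l:ℂ) + m * ((0:ℝ):ℂ)) = 0 := by
      simp [Complex.arg_ofReal_of_nonneg hl.le]
    rw [h4] at h3
    refine h3.congr' ?_
    filter_upwards [eventually_gt_atTop 0] with x hx
    simp only [Function.comp]
    rw [← Complex.arg_real_mul _ hx]
    congr 1
    have : (x:ℂ) ≠ 0 := by exact_mod_cast hx.ne'
    push_cast
    field_simp
  have h := hA.add ((Complex.continuous_im.tendsto 0).comp hE)
  simp only [Complex.zero_im, add_zero] at h
  refine h.congr' ?_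
  filter_upwards [hlin.eventually_gt_atTop 0] with x hx
  rw [digamma_eq _ (by rw [hre]; exact hx)]
  simp [Complex.log_im]

namespace FunEqData

/-- All arguments of the gamma functions have positive real part. -/
def GPos (D : FunEqData) (s : ℂ) : Prop :=
  (∀ j, 0 < ((D.G.lam j : ℂ) * s + D.G.mu j).re) ∧ (∀ j, 0 < ((D.G.lam' j : ℂ) * s + D.G.mu' j).re)

/-- The complete gamma factor. -/
noncomputable def X (D : FunEqData) (s : ℂ) : ℂ := (D.Q : ℂ) ^ s * D.G.toFun s

/-- The logarithmic derivative of the complete gamma factor. -/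
noncomputable def A (D : FunEqData) (s : ℂ) : ℂ :=
  Complex.log D.Q + ((∑ j, (D.G.lam j : ℂ) * Complex.digamma ((D.G.lam j : ℂ) * s + D.G.mu j)) -
    ∑ j, (D.G.lam' j : ℂ) * Complex.digamma ((D.G.lam' j : ℂ) * s + D.G.mu' j))

lemma GPos.regular {D : FunEqData} {s : ℂ} (h : D.GPos s) : D.G.Regular s :=
  ⟨fun j n => ne_neg_nat (h.1 j) n, fun j n => ne_neg_nat (h.2 j) n⟩

end FunEqData

lemma sharp_one {l : ℝ} (hl : 0 < l) {m : ℂ} (h : (-m / (l:ℂ)).re < 1 / 2) : 0 < l * (1/2) + m.re := by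
  rw [Complex.div_ofReal_re, Complex.neg_re, div_lt_iff₀ hl] at h
  linarith

lemma eps_family {n : ℕ} (l : Fin n → ℝ) (hl : ∀ j, 0 < l j) (m : Fin n → ℂ)
    (h : ∀ j, (-(m j) / (l j : ℂ)).re < 1 / 2) :
    ∃ e : ℝ, 0 < e ∧ ∀ s : ℂ, 1 / 2 - e < s.re → ∀ j, 0 < ((l j : ℂ) * s + m j).re := by
  have h1 : ∀ j, ∀ᶠ e : ℝ in 𝓝[>] 0, 0 < l j * (1 / 2 - e) + (m j).re := by
    intro j
    have : ContinuousAt (fun e : ℝ => l j * (1 / 2 - e) + (m j).re) 0 := by fun_prop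
    exact (this.eventually (lt_mem_nhds (by simpa using sharp_one (hl j) (h j)))).filter_mono nhdsWithin_le_nhds
  obtain ⟨e, he, he'⟩ := ((eventually_all.2 h1).and self_mem_nhdsWithin).exists
  refine ⟨e, he', fun s hs j => ?_⟩
  have := he j
  have h3 := mul_lt_mul_of_pos_left hs (hl j)
  simp
  linarith

namespace FunEqData

lemma exists_eps (D : FunEqData) (h : D.G.Sharp) :
    ∃ e : ℝ, 0 < e ∧ ∀ s : ℂ, 1 / 2 - e < s.re → D.GPos s := by
  obtain ⟨e, he, h1⟩ := eps_family D.G.lam D.G.lam_pos D.G.mu h.1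
  obtain ⟨e', he', h2⟩ := eps_family D.G.lam' D.G.lam'_pos D.G.mu' h.2
  refine ⟨min e e', lt_min he he', fun s hs => ⟨h1 s ?_, h2 s ?_⟩⟩
  · have := min_le_left e e'; linarith
  · have := min_le_right e e'; linarith

lemma Q_ne (D : FunEqData) : (D.Q : ℂ) ≠ 0 := by exact_mod_cast D.Q_pos.ne'

lemma X_ne_zero (D : FunEqData) {s : ℂ} (h : D.G.Regular s) : D.X s ≠ 0 := by
  unfold X GammaFactor.toFun
  refine mul_ne_zero ?_ (div_ne_zero ?_ ?_)
  · rw [Complex.cpow_def_of_ne_zero D.Q_ne]; exact Complex.exp_ne_zero _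
  · exact Finset.prod_ne_zero_iff.2 fun j _ => Complex.Gamma_ne_zero (h.1 j)
  · exact Finset.prod_ne_zero_iff.2 fun j _ => Complex.Gamma_ne_zero (h.2 j)

end FunEqData

lemma analytic_gammaprod {n : ℕ} (l : Fin n → ℝ) (m : Fin n → ℂ) {s : ℂ}
    (h : ∀ j, ∀ k : ℕ, (l j : ℂ) * s + m j ≠ -(k : ℂ)) :
    AnalyticAt ℂ (fun s => ∏ j, Complex.Gamma ((l j : ℂ) * s + m j)) s := by
  apply Finset.analyticAt_fun_prod
  intro j _
  have h1 : AnalyticAt ℂ (fun s : ℂ => (l j : ℂ) * s + m j) s := by fun_prop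
  exact (analyticAt_Gamma' (h j)).comp_of_eq h1 rfl

lemma logDeriv_gammaprod {n : ℕ} (l : Fin n → ℝ) (m : Fin n → ℂ) {s : ℂ}
    (h : ∀ j, ∀ k : ℕ, (l j : ℂ) * s + m j ≠ -(k : ℂ)) :
    logDeriv (fun s => ∏ j, Complex.Gamma ((l j : ℂ) * s + m j)) s =
      ∑ j, (l j : ℂ) * Complex.digamma ((l j : ℂ) * s + m j) := by
  have hder : ∀ j, HasDerivAt (fun s : ℂ => Complex.Gamma ((l j : ℂ) * s + m j))
      (deriv Complex.Gamma ((l j : ℂ) * s + m j) * (l j : ℂ)) s := by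
    intro j
    have h1 : HasDerivAt (fun s : ℂ => (l j : ℂ) * s + m j) (l j : ℂ) s := by
      simpa using ((hasDerivAt_id s).const_mul (l j : ℂ)).add_const (m j)
    exact (Complex.differentiableAt_Gamma _ (h j)).hasDerivAt.comp s h1
  rw [logDeriv_prod]
  · refine Finset.sum_congr rfl fun j _ => ?_
    rw [logDeriv_apply, (hder j).deriv, Complex.digamma_def, logDeriv_apply]
    ring
  · exact fun j _ => Complex.Gamma_ne_zero (h j)
  · exact fun j _ => (hder j).differentiableAt

namespace FunEqData

lemma X_analyticAt (D : FunEqData) {s : ℂ} (h : D.G.Regular s) : AnalyticAt ℂ D.X s := by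
  unfold X GammaFactor.toFun
  refine AnalyticAt.mul ?_ (AnalyticAt.div ?_ ?_ ?_)
  · have : (fun s => (D.Q : ℂ) ^ s) = fun s => Complex.exp (Complex.log D.Q * s) := by
      ext s; rw [Complex.cpow_def_of_ne_zero D.Q_ne]
    change AnalyticAt ℂ (fun s => (D.Q : ℂ) ^ s) s
    rw [this]; fun_prop
  · exact analytic_gammaprod _ _ h.1
  · exact analytic_gammaprod _ _ h.2
  · exact Finset.prod_ne_zero_iff.2 fun j _ => Complex.Gamma_ne_zero (h.2 j)

lemma logDeriv_X (D : FunEqData) {s : ℂ} (h : D.G.Regular s) : logDeriv D.X s = D.A s := by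
  have hQ : HasDerivAt (fun s => (D.Q : ℂ) ^ s) ((D.Q : ℂ) ^ s * Complex.log D.Q) s := by
    simpa using (hasDerivAt_id s).const_cpow (c := (D.Q : ℂ)) (Or.inl D.Q_ne)
  have hQ0 : (D.Q : ℂ) ^ s ≠ 0 := by
    rw [Complex.cpow_def_of_ne_zero D.Q_ne]; exact Complex.exp_ne_zero _
  have n1 : (∏ j, Complex.Gamma ((D.G.lam j : ℂ) * s + D.G.mu j)) ≠ 0 :=
    Finset.prod_ne_zero_iff.2 fun j _ => Complex.Gamma_ne_zero (h.1 j)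
  have n2 : (∏ j, Complex.Gamma ((D.G.lam' j : ℂ) * s + D.G.mu' j)) ≠ 0 :=
    Finset.prod_ne_zero_iff.2 fun j _ => Complex.Gamma_ne_zero (h.2 j)
  have a1 := (analytic_gammaprod _ _ h.1).differentiableAt
  have a2 := (analytic_gammaprod _ _ h.2).differentiableAt
  have m1 := logDeriv_mul (f := fun s => (D.Q : ℂ) ^ s)
    (g := fun s => (∏ j, Complex.Gamma ((D.G.lam j : ℂ) * s + D.G.mu j)) /
      ∏ j, Complex.Gamma ((D.G.lam' j : ℂ) * s + D.G.mu' j)) s hQ0 (div_ne_zero n1 n2)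
    hQ.differentiableAt (a1.div a2 n2)
  have m2 := logDeriv_div (f := fun s => ∏ j, Complex.Gamma ((D.G.lam j : ℂ) * s + D.G.mu j))
    (g := fun s => ∏ j, Complex.Gamma ((D.G.lam' j : ℂ) * s + D.G.mu' j)) s n1 n2 a1 a2
  refine m1.trans ?_
  rw [logDeriv_apply, hQ.deriv, mul_div_cancel_left₀ _ hQ0]
  refine congrArg (fun t => Complex.log D.Q + t) (m2.trans ?_)
  rw [logDeriv_gammaprod _ _ h.1, logDeriv_gammaprod _ _ h.2]

end FunEqData

lemma diff_sum {n : ℕ} (l : Fin n → ℝ) (m : Fin n → ℂ) {s : ℂ}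
    (h : ∀ j, 0 < ((l j : ℂ) * s + m j).re) :
    DifferentiableAt ℂ (fun s => ∑ j, (l j : ℂ) * Complex.digamma ((l j : ℂ) * s + m j)) s := by
  apply DifferentiableAt.fun_sum
  intro j _
  have h1 : DifferentiableAt ℂ (fun s : ℂ => (l j : ℂ) * s + m j) s := by fun_prop
  exact ((digamma_analyticAt _ (h j)).differentiableAt.comp s h1).const_mul _

lemma bound_sum {n : ℕ} (l : Fin n → ℝ) (hl : ∀ j, 0 < l j) (m : Fin n → ℂ)
    (h : ∀ j, (-(m j) / (l j : ℂ)).re < 1 / 2) :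
    ∃ C : ℝ, ∀ s : ℂ, 1 / 2 ≤ s.re →
      ‖∑ j, (l j : ℂ) * Complex.digamma ((l j : ℂ) * s + m j)‖ ≤ C * √(1 + ‖s‖) := by
  have h1 : ∀ j, ∃ C : ℝ, ∀ s : ℂ, 1 / 2 ≤ s.re →
      ‖(l j : ℂ) * Complex.digamma ((l j : ℂ) * s + m j)‖ ≤ C * √(1 + ‖s‖) := by
    intro j
    obtain ⟨C, hC⟩ := digamma_bound _ (sharp_one (hl j) (h j))
    refine ⟨l j * (|C| + 2 * √(l j + ‖m j‖)), fun s hs => ?_⟩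
    have h2 := hC ((l j : ℂ) * s + m j) (by simp; linarith [mul_le_mul_of_nonneg_left hs (hl j).le])
    rw [norm_mul, Complex.norm_real, Real.norm_of_nonneg (hl j).le, mul_assoc]
    refine mul_le_mul_of_nonneg_left (h2.trans ?_) (hl j).le
    have h3 : ‖(l j : ℂ) * s + m j‖ ≤ (l j + ‖m j‖) * (1 + ‖s‖) := by
      refine (norm_add_le _ _).trans ?_
      rw [norm_mul, Complex.norm_real, Real.norm_of_nonneg (hl j).le]
      nlinarith [norm_nonneg s, norm_nonneg (m j), hl j, mul_nonneg (norm_nonneg s) (norm_nonneg (m j))]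
    have h4 := Real.sqrt_le_sqrt h3
    rw [Real.sqrt_mul (by have := hl j; positivity)] at h4
    have h5 : 1 ≤ √(1 + ‖s‖) := by
      rw [Real.one_le_sqrt]; linarith [norm_nonneg s]
    have h6 : C ≤ |C| * √(1 + ‖s‖) := (le_abs_self C).trans (le_mul_of_one_le_right (abs_nonneg C) h5)
    rw [add_mul]
    linarith
  choose C hC using h1
  refine ⟨∑ j, C j, fun s hs => ?_⟩
  rw [Finset.sum_mul]
  exact (norm_sum_le _ _).trans (Finset.sum_le_sum fun j _ => hC j s hs)

lemma im_sum {n : ℕ} (l : Fin n → ℝ) (hl : ∀ j, 0 < l j) (m : Fin n → ℂ) :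
    Tendsto (fun x : ℝ => (∑ j, (l j : ℂ) * Complex.digamma ((l j : ℂ) * x + m j)).im) atTop (𝓝 0) := by
  simp only [Complex.im_sum, Complex.im_ofReal_mul]
  have : Tendsto (fun x : ℝ => ∑ j, l j * (Complex.digamma ((l j : ℂ) * x + m j)).im) atTop (𝓝 (∑ j, l j * 0)) :=
    tendsto_finsetSum _ fun j _ => (digamma_im (l j) (hl j) (m j)).const_mul _
  simpa using this

namespace FunEqData

lemma A_diff (D : FunEqData) {s : ℂ} (h : D.GPos s) : DifferentiableAt ℂ D.A s :=
  ((diff_sum _ _ h.1).sub (diff_sum _ _ h.2)).const_add _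

lemma A_bound (D : FunEqData) (h : D.G.Sharp) :
    ∃ C : ℝ, ∀ s : ℂ, 1 / 2 ≤ s.re → ‖D.A s‖ ≤ C * √(1 + ‖s‖) := by
  obtain ⟨C1, h1⟩ := bound_sum _ D.G.lam_pos _ h.1
  obtain ⟨C2, h2⟩ := bound_sum _ D.G.lam'_pos _ h.2
  refine ⟨‖Complex.log D.Q‖ + (C1 + C2), fun s hs => ?_⟩
  have h5 : 1 ≤ √(1 + ‖s‖) := by
    rw [Real.one_le_sqrt]; linarith [norm_nonneg s]
  have h6 := le_mul_of_one_le_right (norm_nonneg (Complex.log D.Q)) h5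
  unfold A
  refine (norm_add_le _ _).trans ?_
  have h7 := norm_sub_le (∑ j, (D.G.lam j : ℂ) * Complex.digamma ((D.G.lam j : ℂ) * s + D.G.mu j))
    (∑ j, (D.G.lam' j : ℂ) * Complex.digamma ((D.G.lam' j : ℂ) * s + D.G.mu' j))
  have := h1 s hs
  have := h2 s hs
  linarith

lemma A_im (D : FunEqData) : Tendsto (fun x : ℝ => (D.A x).im) atTop (𝓝 0) := by
  have h := (im_sum _ D.G.lam_pos D.G.mu).sub (im_sum _ D.G.lam'_pos D.G.mu')
  have h0 : (Complex.log D.Q).im = 0 := by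
    rw [← Complex.ofReal_log D.Q_pos.le]; simp
  simpa [A, h0] using h

end FunEqData

lemma liouville_sqrt (H : ℂ → ℂ) (hH : Differentiable ℂ H) (C : ℝ)
    (hb : ∀ s, ‖H s‖ ≤ C * √(1 + ‖s‖)) (s : ℂ) : H s = H 0 := by
  have hC : 0 ≤ C := by
    have := (norm_nonneg _).trans (hb 0); simpa using this
  have hd : ∀ c, deriv H c = 0 := by
    intro c
    have hle : ∀ R : ℝ, 0 < R → ‖deriv H c‖ ≤ C * √(1 + (‖c‖ + R)) / R := by
      intro R hR
      apply Complex.norm_deriv_le_of_forall_mem_sphere_norm_le hR hH.diffContOnCl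
      intro z hz
      refine (hb z).trans ?_
      have : ‖z‖ ≤ ‖c‖ + R := by
        have h1 : ‖z - c‖ = R := by simpa [dist_eq_norm] using hz
        have h2 := norm_add_le c (z - c)
        rw [h1] at h2; simpa using h2
      gcongr
    have hlim : Tendsto (fun R : ℝ => C * √((1 + ‖c‖) * (R⁻¹) ^ 2 + R⁻¹)) atTop (𝓝 0) := by
      have hcont : Continuous (fun u : ℝ => C * √((1 + ‖c‖) * u ^ 2 + u)) := by fun_prop
      have := (hcont.tendsto 0).comp tendsto_inv_atTop_zero
      simpa [Function.comp_def] using this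
    have : ‖deriv H c‖ ≤ 0 := by
      refine ge_of_tendsto hlim ?_
      filter_upwards [eventually_gt_atTop 0] with R hR
      refine (hle R hR).trans (le_of_eq ?_)
      have e : (1 + ‖c‖) * (R⁻¹) ^ 2 + R⁻¹ = (1 + (‖c‖ + R)) / R ^ 2 := by field_simp; ring
      rw [e, Real.sqrt_div (by positivity), Real.sqrt_sq hR.le]
      ring
    simpa using this
  exact is_const_of_deriv_eq_zero hH hd s 0

lemma g_ne_zero (L : LSharp) : ∃ s, L.g s ≠ 0 := by
  by_contra! hg
  have hfin : {z : ℂ | L.P.eval z = 0}.Finite := by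
    have := L.P.rootSet_finite ℂ
    refine this.subset fun z hz => ?_
    rw [Polynomial.mem_rootSet]
    exact ⟨L.P_ne_zero, by simpa using hz⟩
  have hev : ∀ᶠ x : ℝ in atTop, L.P.eval (x : ℂ) ≠ 0 := by
    have h1 : {x : ℝ | L.P.eval (x:ℂ) = 0}.Finite := hfin.preimage (f := fun x : ℝ => (x : ℂ)) Complex.ofReal_injective.injOn
    obtain ⟨M, hM⟩ := h1.bddAbove
    filter_upwards [eventually_gt_atTop M] with x hx h
    exact absurd (hM h) (not_le.2 hx)
  have h2 : (fun x : ℝ ↦ LSeries L.a x) =ᶠ[atTop] 0 := by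
    obtain ⟨y, hy, -⟩ := EReal.lt_iff_exists_real_btwn.1 L.abscissa_lt_top
    filter_upwards [hev, eventually_gt_atTop y] with x hx hxy
    rw [← L.F_eq_LSeries x (hy.trans (by simpa using hxy)), L.F_eq_g_div_P _ hx, hg]
    simp
  rcases LSeries_eventually_eq_zero_iff'.1 h2 with h | h
  · obtain ⟨n, hn⟩ := L.a_ne_zero
    by_cases h0 : n = 0
    · exact hn (h0 ▸ L.a_zero)
    · exact hn (h n h0)
  · exact absurd h L.abscissa_lt_top.ne

lemma refl_diff {f : ℂ → ℂ} {f' s : ℂ} (h : HasDerivAt f f' (1 - conj s)) :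
    HasDerivAt (fun s => conj (f (1 - conj s))) (-conj f') s := by
  have e : (1 : ℂ) - conj s = conj (1 - s) := by simp
  rw [e] at h
  have h1 := h.conj_conj
  simp only [Complex.conj_conj] at h1
  have h2 : HasDerivAt (fun s : ℂ => 1 - s) (-1) s := by
    simpa using (hasDerivAt_id s).const_sub 1
  have h3 := h1.comp s h2
  have e2 : (fun s => conj (f (1 - conj s))) = (conj ∘ f ∘ conj) ∘ (fun s : ℂ => 1 - s) := by
    ext s; simp
  rw [e2]
  exact h3.congr_deriv (by simp)

lemma good_ev (L : LSharp) : ∀ᶠ s in 𝓝[≠] (1/2 : ℂ),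
    L.g s ≠ 0 ∧ L.P.eval s ≠ 0 ∧ L.P.eval (1 - conj s) ≠ 0 := by
  have key : ∀ f : ℂ → ℂ, Differentiable ℂ f → (∃ s, f s ≠ 0) → ∀ᶠ s in 𝓝[≠] (1/2 : ℂ), f s ≠ 0 := by
    intro f hf ⟨s, hs⟩
    by_contra hcon
    have hfr : ∃ᶠ z in 𝓝[≠] (1/2 : ℂ), f z = 0 := by
      rw [not_eventually] at hcon; simpa using hcon
    have han : AnalyticOnNhd ℂ f Set.univ := fun z _ => hf.analyticAt z
    exact hs (han.eqOn_zero_of_preconnected_of_frequently_eq_zero isPreconnected_univ (Set.mem_univ _) hfr (Set.mem_univ s))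
  obtain ⟨z, hz⟩ : ∃ s, L.P.eval s ≠ 0 := by
    by_contra! h
    exact L.P_ne_zero (Polynomial.funext (by simpa using h))
  have h1 := key L.g L.g_entire (g_ne_zero L)
  have h2 := key (fun s => L.P.eval s) L.P.differentiable ⟨z, hz⟩
  have h3 := key (fun s => conj (L.P.eval (1 - conj s)))
    (fun s => (refl_diff (f := fun s => L.P.eval s) (L.P.differentiable _).hasDerivAt).differentiableAt)
    ⟨1 - conj z, by simpa using hz⟩
  filter_upwards [h1, h2, h3] with s a b c
  exact ⟨a, b, by simpa using c⟩

/-- **Theorem (uniqueness of the functional equation in 𝔄^∞).** If `F` satisfies (P1), (P2)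
and two functional equations of the form required by (P3'), then the complete gamma data
agree up to a constant: `Q_1^s G_1(s) = c · Q_2^s G_2(s)`. -/
theorem funEq_unique_of_sharp (L : LSharp) (D₁ D₂ : FunEqData)
    (hs₁ : D₁.G.Sharp) (hs₂ : D₂.G.Sharp)
    (h₁ : D₁.HoldsOff L.F {z | L.P.eval z = 0})
    (h₂ : D₂.HoldsOff L.F {z | L.P.eval z = 0}) :
    ∃ c : ℂ, ∀ s : ℂ, D₁.G.Regular s → D₂.G.Regular s →
      (D₁.Q : ℂ) ^ s * D₁.G.toFun s = c * ((D₂.Q : ℂ) ^ s * D₂.G.toFun s) := by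
  obtain ⟨e, he, hpos⟩ : ∃ e : ℝ, 0 < e ∧ ∀ s : ℂ, 1 / 2 - e < s.re → D₁.GPos s ∧ D₂.GPos s := by
    obtain ⟨e, he, h1⟩ := D₁.exists_eps hs₁
    obtain ⟨e', he', h2⟩ := D₂.exists_eps hs₂
    refine ⟨min e e', lt_min he he', fun s hs => ⟨h1 s ?_, h2 s ?_⟩⟩
    · have := min_le_left e e'; linarith
    · have := min_le_right e e'; linarith
  set R : ℂ → ℂ := fun s => D₁.X s / D₂.X s with hR
  set B : ℂ → ℂ := fun s => D₁.A s - D₂.A s with hB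
  have hRan : ∀ s : ℂ, 1 / 2 - e < s.re → AnalyticAt ℂ R s := fun s hs =>
    (D₁.X_analyticAt (hpos s hs).1.regular).div (D₂.X_analyticAt (hpos s hs).2.regular)
      (D₂.X_ne_zero (hpos s hs).2.regular)
  have hR0 : ∀ s : ℂ, 1 / 2 - e < s.re → R s ≠ 0 := fun s hs =>
    div_ne_zero (D₁.X_ne_zero (hpos s hs).1.regular) (D₂.X_ne_zero (hpos s hs).2.regular)
  have hRd : ∀ s : ℂ, 1 / 2 - e < s.re → HasDerivAt R (R s * B s) s := by
    intro s hs
    have r1 := (hpos s hs).1.regular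
    have r2 := (hpos s hs).2.regular
    have h := logDeriv_div s (D₁.X_ne_zero r1) (D₂.X_ne_zero r2) (D₁.X_analyticAt r1).differentiableAt
      (D₂.X_analyticAt r2).differentiableAt
    rw [D₁.logDeriv_X r1, D₂.logDeriv_X r2, logDeriv_apply, div_eq_iff (hR0 s hs)] at h
    have h' := (hRan s hs).differentiableAt.hasDerivAt
    have h'' : deriv R s = R s * B s := by rw [mul_comm]; exact h
    rwa [h''] at h'
  have hBd : ∀ s : ℂ, 1 / 2 - e < s.re → DifferentiableAt ℂ B s := fun s hs =>
    (D₁.A_diff (hpos s hs).1).sub (D₂.A_diff (hpos s hs).2)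
  -- the strip
  set S : Set ℂ := {s | 1 / 2 - e < s.re} ∩ {s | s.re < 1 / 2 + e} with hS
  have hSo : IsOpen S := (isOpen_lt continuous_const Complex.continuous_re).inter
    (isOpen_lt Complex.continuous_re continuous_const)
  have hSc : IsPreconnected S := ((convex_halfSpace_re_gt _).inter (convex_halfSpace_re_lt _)).isPreconnected
  have hrefl : ∀ s : ℂ, s.re < 1 / 2 + e → 1 / 2 - e < (1 - conj s).re := by
    intro s hs; simp; linarith
  have hrefld : ∀ s : ℂ, s.re < 1 / 2 + e → HasDerivAt (fun s => conj (R (1 - conj s)))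
      (-conj (R (1 - conj s) * B (1 - conj s))) s := fun s hs => refl_diff (hRd _ (hrefl s hs))
  set η : ℂ := D₁.ω / D₂.ω with hη
  have hω2 : D₂.ω ≠ 0 := by
    intro h; have := D₂.ω_norm; rw [h] at this; simp at this
  have hhalf : (1/2 : ℂ) ∈ S := by
    constructor
    · show 1 / 2 - e < (1/2 : ℂ).re
      norm_num; exact he
    · show (1/2 : ℂ).re < 1 / 2 + e
      norm_num; exact he
  have hfe : Set.EqOn R (fun s => η * conj (R (1 - conj s))) S := by
    have a1 : AnalyticOnNhd ℂ R S := fun s hs => hRan s hs.1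
    have a2 : AnalyticOnNhd ℂ (fun s => η * conj (R (1 - conj s))) S := by
      apply DifferentiableOn.analyticOnNhd _ hSo
      intro s hs
      exact ((hrefld s hs.2).differentiableAt.const_mul η).differentiableWithinAt
    refine a1.eqOn_of_preconnected_of_frequently_eq a2 hSc hhalf (Eventually.frequently ?_)
    filter_upwards [good_ev L, nhdsWithin_le_nhds (hSo.mem_nhds hhalf)] with s ⟨hg, hP, hP'⟩ hs
    have p := hpos s hs.1
    have q := hpos _ (hrefl s hs.2)
    have f1 := h₁ s hP hP' p.1.regular q.1.regular
    have f2 := h₂ s hP hP' p.2.regular q.2.regular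
    have hF : L.F s ≠ 0 := by
      rw [L.F_eq_g_div_P s hP]; exact div_ne_zero hg hP
    change D₁.X s * L.F s = D₁.ω * conj (D₁.X (1 - conj s) * L.F (1 - conj s)) at f1
    change D₂.X s * L.F s = D₂.ω * conj (D₂.X (1 - conj s) * L.F (1 - conj s)) at f2
    have n2 := D₂.X_ne_zero p.2.regular
    have n2' := D₂.X_ne_zero q.2.regular
    have n2'' : conj (D₂.X (1 - conj s)) ≠ 0 := by simpa using n2'
    show D₁.X s / D₂.X s = D₁.ω / D₂.ω * conj (D₁.X (1 - conj s) / D₂.X (1 - conj s))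
    rw [map_mul] at f1 f2
    rw [map_div₀]
    generalize conj (D₁.X (1 - conj s)) = y1 at *
    generalize conj (D₂.X (1 - conj s)) = y2 at *
    generalize conj (L.F (1 - conj s)) = u at *
    rw [div_mul_div_comm, div_eq_div_iff n2 (mul_ne_zero hω2 n2'')]
    apply mul_right_cancel₀ hF
    linear_combination (D₂.ω * y2) * f1 - D₁.ω * y1 * f2
  have hBfe : ∀ s ∈ S, B s = - conj (B (1 - conj s)) := by
    intro s hs
    have d1 := hRd s hs.1
    have d2 := (hrefld s hs.2).const_mul η
    have d3 := d1.congr_of_eventuallyEq (hfe.symm.eventuallyEq_of_mem (hSo.mem_nhds hs))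
    have d4 := d3.unique d2
    have h5 := hfe hs
    apply mul_left_cancel₀ (hR0 s hs.1)
    rw [d4, h5, map_mul]; ring
  -- the entire function
  classical
  set H : ℂ → ℂ := fun s => if 1 / 2 - e < s.re then B s else - conj (B (1 - conj s)) with hH
  have hH1 : ∀ s : ℂ, 1 / 2 - e < s.re → H s = B s := fun s hs => if_pos hs
  have hH2 : ∀ s : ℂ, s.re < 1 / 2 + e → H s = - conj (B (1 - conj s)) := by
    intro s hs
    by_cases h : 1 / 2 - e < s.re
    · rw [hH1 s h]; exact hBfe s ⟨h, hs⟩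
    · exact if_neg h
  have hHd : Differentiable ℂ H := by
    intro s
    by_cases h : 1 / 2 - e < s.re
    · refine (hBd s h).congr_of_eventuallyEq ?_
      filter_upwards [(isOpen_lt continuous_const Complex.continuous_re).mem_nhds h] with z hz
      exact hH1 z hz
    · have h' : s.re < 1 / 2 + e := by linarith
      refine (refl_diff (hBd _ (hrefl s h')).hasDerivAt).differentiableAt.neg.congr_of_eventuallyEq ?_
      filter_upwards [(isOpen_lt Complex.continuous_re continuous_const).mem_nhds h'] with z hz
      exact hH2 z hz
  obtain ⟨C, hC⟩ : ∃ C : ℝ, ∀ s : ℂ, 1 / 2 ≤ s.re → ‖B s‖ ≤ C * √(1 + ‖s‖) := by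
    obtain ⟨C1, c1⟩ := D₁.A_bound hs₁
    obtain ⟨C2, c2⟩ := D₂.A_bound hs₂
    refine ⟨C1 + C2, fun s hs => (norm_sub_le _ _).trans ?_⟩
    linarith [c1 s hs, c2 s hs]
  have hHb : ∀ s, ‖H s‖ ≤ (|C| * √2) * √(1 + ‖s‖) := by
    have aux : ∀ s z : ℂ, 1 / 2 ≤ z.re → ‖z‖ ≤ 1 + ‖s‖ → ‖B z‖ ≤ (|C| * √2) * √(1 + ‖s‖) := by
      intro s z hz hzs
      refine (hC z hz).trans ?_
      rw [mul_assoc, ← Real.sqrt_mul (by norm_num)]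
      have : √(1 + ‖z‖) ≤ √(2 * (1 + ‖s‖)) := Real.sqrt_le_sqrt (by linarith [norm_nonneg s])
      exact (mul_le_mul_of_nonneg_right (le_abs_self C) (Real.sqrt_nonneg _)).trans
        (mul_le_mul_of_nonneg_left this (abs_nonneg C))
    intro s
    by_cases h : 1 / 2 ≤ s.re
    · rw [hH1 s (by linarith)]
      exact aux s s h (by linarith)
    · rw [hH2 s (by linarith), norm_neg, RCLike.norm_conj]
      refine aux s _ (by simp; linarith) ((norm_sub_le _ _).trans ?_)
      rw [RCLike.norm_conj]; simp
  have hconst := liouville_sqrt H hHd _ hHb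
  have hre : (H 0).re = 0 := by
    have h1 := hH1 (1/2) hhalf.1
    have h2 := hH2 (1/2) hhalf.2
    have e1 : (1 : ℂ) - conj (1/2 : ℂ) = 1/2 := by
      have e0 : (1/2 : ℂ) = ((1/2 : ℝ) : ℂ) := by push_cast; rfl
      rw [e0, Complex.conj_ofReal]; push_cast; norm_num
    rw [e1, ← h1, hconst (1/2)] at h2
    have := congrArg Complex.re h2
    simp at this
    linarith
  have him : (H 0).im = 0 := by
    have h1 := D₁.A_im.sub D₂.A_im
    rw [sub_zero] at h1
    have h2 : Tendsto (fun x : ℝ => (D₁.A x).im - (D₂.A x).im) atTop (𝓝 (H 0).im) := by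
      refine tendsto_const_nhds.congr' ?_
      filter_upwards [eventually_gt_atTop (1/2)] with x hx
      rw [← hconst x, hH1 x (by simp; linarith)]
      simp [hB]
    exact tendsto_nhds_unique h2 h1
  have hB0 : ∀ s : ℂ, 1 / 2 - e < s.re → B s = 0 := by
    intro s hs
    rw [← hH1 s hs, hconst s]
    exact Complex.ext hre him
  -- R is constant near 1/2
  have hUo : IsOpen {s : ℂ | 1 / 2 - e < s.re} := isOpen_lt continuous_const Complex.continuous_re
  have hRc : ∀ s : ℂ, 1 / 2 - e < s.re → R s = R (1/2) := by
    intro s hs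
    refine hUo.is_const_of_deriv_eq_zero (convex_halfSpace_re_gt _).isPreconnected
      (fun z hz => (hRan z hz).differentiableAt.differentiableWithinAt) ?_ hs hhalf.1
    intro z hz
    rw [(hRd z hz).deriv, hB0 z hz]; simp
  refine ⟨R (1/2), fun s r1 r2 => ?_⟩
  show D₁.X s = R (1/2) * D₂.X s
  -- extension to the regular set
  have hcount : ∀ (l : ℝ) (m : ℂ), 0 < l → {s : ℂ | ∃ n : ℕ, (l : ℂ) * s + m = -(n : ℂ)}.Countable := by
    intro l m hl
    refine (Set.countable_range (fun n : ℕ => (-(n : ℂ) - m) / l)).mono ?_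
    rintro s ⟨n, hn⟩
    refine ⟨n, ?_⟩
    have : (l : ℂ) ≠ 0 := by exact_mod_cast hl.ne'
    show (-(n : ℂ) - m) / l = s
    rw [← hn]; field_simp; ring
  have hreg : ∀ D : FunEqData, {s : ℂ | D.G.Regular s}ᶜ.Countable := by
    intro D
    have c1 : (⋃ j, {s : ℂ | ∃ n : ℕ, (D.G.lam j : ℂ) * s + D.G.mu j = -(n : ℂ)}).Countable :=
      Set.countable_iUnion fun j => hcount _ _ (D.G.lam_pos j)
    have c2 : (⋃ j, {s : ℂ | ∃ n : ℕ, (D.G.lam' j : ℂ) * s + D.G.mu' j = -(n : ℂ)}).Countable :=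
      Set.countable_iUnion fun j => hcount _ _ (D.G.lam'_pos j)
    refine (c1.union c2).mono ?_
    intro s hs
    by_contra hcon
    apply hs
    simp only [Set.mem_union, Set.mem_iUnion, Set.mem_ofPred_eq, not_or, not_exists] at hcon
    exact ⟨hcon.1, hcon.2⟩
  have hconn : IsPreconnected (({s : ℂ | D₁.G.Regular s}ᶜ ∪ {s : ℂ | D₂.G.Regular s}ᶜ)ᶜ) :=
    (((hreg D₁).union (hreg D₂)).isConnected_compl_of_one_lt_rank (by
      rw [Complex.rank_real_complex]; exact Cardinal.one_lt_two)).isPreconnected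
  have hset : ({s : ℂ | D₁.G.Regular s}ᶜ ∪ {s : ℂ | D₂.G.Regular s}ᶜ)ᶜ =
      {s : ℂ | D₁.G.Regular s ∧ D₂.G.Regular s} := by
    ext s; simp
  rw [hset] at hconn
  have a1 : AnalyticOnNhd ℂ D₁.X {s : ℂ | D₁.G.Regular s ∧ D₂.G.Regular s} :=
    fun z hz => D₁.X_analyticAt hz.1
  have a2 : AnalyticOnNhd ℂ (fun z => R (1/2) * D₂.X z) {s : ℂ | D₁.G.Regular s ∧ D₂.G.Regular s} :=
    fun z hz => analyticAt_const.mul (D₂.X_analyticAt hz.2)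
  have hp := hpos _ hhalf.1
  refine a1.eqOn_of_preconnected_of_eventuallyEq a2 hconn (z₀ := 1/2) ⟨hp.1.regular, hp.2.regular⟩ ?_ ⟨r1, r2⟩
  filter_upwards [hUo.mem_nhds hhalf.1] with z hz
  rw [← hRc z hz]
  exact (div_mul_cancel₀ _ (D₂.X_ne_zero (hpos z hz).2.regular)).symm
end
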